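/- Let a = (a_n) ∈ (0,1)^ℕ be such that the set {n ∈ ℕ : a_n > 1/3} is infinite, with k_0 = 0 (i.e., a_1 < 1/3), and assume condition (*) holds for every n ∈ ℕ. Then C(a) − C(a) = [−1,1] ∖ ⋃𝒢_∅, and the Lebesgue measure of C(a) − C(a) equals 2 − 2·∑_{n=1}^∞ 3^{n−1}·(d_{k_n−1} − 3d_{k_n}). -/

import Mathlib

open Pointwise MeasureTheory

namespace CCS

/-- `dSeq a n` is the common length `d_n = ∏_{i=1}^n (1 - a_i)/2` of the intervals of the
`n`-th step of the construction of the central Cantor set `C(a)` (`d_0 = 1`).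
The sequence `a` is indexed from `1`; the value `a 0` is irrelevant. -/
noncomputable def dSeq (a : ℕ → ℝ) (n : ℕ) : ℝ :=
  ∏ i ∈ Finset.Icc 1 n, ((1 - a i) / 2)

/-- Left endpoint of the interval `I_t`, `t ∈ {0,1}^n` (coded as a list, the paper's
`t_j` being `t.getD (j-1) 0`): `l(I_t) = ∑_{j=1}^n t_j (d_{j-1} - d_j)`. -/
noncomputable def Il (a : ℕ → ℝ) (t : List ℕ) : ℝ :=
  ∑ j ∈ Finset.range t.length, (t.getD j 0 : ℝ) * (dSeq a j - dSeq a (j + 1))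

/-- The `n`-th step `C_n(a)` of the construction of the central Cantor set:
the union of the intervals `I_t = [l(I_t), l(I_t) + d_n]` over `t ∈ {0,1}^n`. -/
noncomputable def cantorStep (a : ℕ → ℝ) (n : ℕ) : Set ℝ :=
  ⋃ t ∈ {t : List ℕ | t.length = n ∧ ∀ j ∈ t, j ≤ 1},
    Set.Icc (Il a t) (Il a t + dSeq a n)

/-- The central Cantor set `C(a) = ⋂ₙ C_n(a)`. -/
noncomputable def cantorSet (a : ℕ → ℝ) : Set ℝ := ⋂ n, cantorStep a n

/-- Left endpoint of the interval `J_s = I_t - I_p`, for `s ∈ {0,1,2}^n`: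
`l(J_s) = -1 + ∑_{j=1}^n s_j (d_{j-1} - d_j)`. -/
noncomputable def Jl (a : ℕ → ℝ) (s : List ℕ) : ℝ :=
  -1 + ∑ j ∈ Finset.range s.length, (s.getD j 0 : ℝ) * (dSeq a j - dSeq a (j + 1))

/-- Right endpoint of `J_s`: `r(J_s) = l(J_s) + 2 d_n`. -/
noncomputable def Jr (a : ℕ → ℝ) (s : List ℕ) : ℝ :=
  Jl a s + 2 * dSeq a s.length

/-- The interval `J_s`. -/
noncomputable def Jset (a : ℕ → ℝ) (s : List ℕ) : Set ℝ := Set.Icc (Jl a s) (Jr a s)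

/-- Left endpoint of the gap `G^i_s` (`i = 0`: left gap, `i = 1`: right gap) of `J_s`. -/
noncomputable def Gl (a : ℕ → ℝ) (i : ℕ) (s : List ℕ) : ℝ :=
  Jl a s + (i : ℝ) * (dSeq a s.length - dSeq a (s.length + 1)) + 2 * dSeq a (s.length + 1)

/-- Right endpoint of the gap `G^i_s`. -/
noncomputable def Gr (a : ℕ → ℝ) (i : ℕ) (s : List ℕ) : ℝ :=
  Jl a s + ((i : ℝ) + 1) * (dSeq a s.length - dSeq a (s.length + 1))

/-- The gap `G^i_s ⊆ J_s`, an open interval. -/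
noncomputable def Gset (a : ℕ → ℝ) (i : ℕ) (s : List ℕ) : Set ℝ :=
  Set.Ioo (Gl a i s) (Gr a i s)

/-- `N(0,s) = max {j : s_j > 0}`, `N(1,s) = max {j : s_j < 2}` (1-based, `max ∅ = 0`). -/
noncomputable def Nidx (i : ℕ) (s : List ℕ) : ℕ :=
  sSup {j | 1 ≤ j ∧ j ≤ s.length ∧
    (if i = 0 then 0 < s.getD (j - 1) 0 else s.getD (j - 1) 0 < 2)}

/-- The family `𝒢^{i0}_{s0}(n)` of (indices of) gaps of rank `n`, for
`s0 ∈ {0,1,2}^{k_m - 1}`; a gap `G^i_s` is coded by the pair `(i, s)`.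
`𝒢^{i0}_{s0}(m) = {G^{i0}_{s0}}` and for `n > m`,
`𝒢^{i0}_{s0}(n)` consists of the gap `Ḡ^{i0}_{s0}(n)` together with the gaps
`Ḡ^1_{t^j}(n)`, `Ḡ^0_{t^(j+1)}(n)` for all `G^j_t ∈ 𝒢^{i0}_{s0}(l)`, `m ≤ l < n`. -/
def gapFamily (k : ℕ → ℕ) (i0 : ℕ) (s0 : List ℕ) (m : ℕ) (n : ℕ) : Set (ℕ × List ℕ) :=
  if n ≤ m then {(i0, s0)}
  else
    {(i0, s0 ++ List.replicate (k n - k m) (2 * i0))} ∪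
      ⋃ (l : ℕ) (_ : m ≤ l) (hl : l < n),
        ⋃ p ∈ gapFamily k i0 s0 m l,
          ({(1, p.2 ++ p.1 :: List.replicate (k n - k l - 1) 2),
            (0, p.2 ++ (p.1 + 1) :: List.replicate (k n - k l - 1) 0)} : Set (ℕ × List ℕ))
termination_by n
decreasing_by exact hl

/-- The family `𝒢^{i0}_{s0} = ⋃_{n ≥ m} 𝒢^{i0}_{s0}(n)`. -/
def gapFamilyAll (k : ℕ → ℕ) (i0 : ℕ) (s0 : List ℕ) (m : ℕ) : Set (ℕ × List ℕ) :=
  ⋃ (n : ℕ) (_ : m ≤ n), gapFamily k i0 s0 m n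

/-- The family `𝒢_t := 𝒢^0_{t ++ 0^{(k_m - |t| - 1)}} ∪ 𝒢^1_{t ++ 2^{(k_m - |t| - 1)}}`
for `t ∈ {0,1,2}^k` with `k_{m-1} ≤ k < k_m`. -/
def gapFamilyT (k : ℕ → ℕ) (m : ℕ) (t : List ℕ) : Set (ℕ × List ℕ) :=
  gapFamilyAll k 0 (t ++ List.replicate (k m - t.length - 1) 0) m ∪
    gapFamilyAll k 1 (t ++ List.replicate (k m - t.length - 1) 2) m

/-- The union `⋃ 𝒢` of a family of (indices of) gaps, as a subset of `ℝ`. -/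
noncomputable def gapUnion (a : ℕ → ℝ) (G : Set (ℕ × List ℕ)) : Set ℝ :=
  ⋃ p ∈ G, Gset a p.1 p.2

/-- `padSeq k c s m n` is the index of the gap `G^i(s,n)` (for `c = 2i`):
`s ++ c^{(k_m - |s| - 1)} ++ 1 ++ c^{(k_{m+1} - k_m - 1)} ++ 1 ++ ⋯ ++ 1 ++ c^{(k_n - k_{n-1} - 1)}`. -/
def padSeq (k : ℕ → ℕ) (c : ℕ) (s : List ℕ) (m : ℕ) : ℕ → List ℕ
  | 0 => s ++ List.replicate (k m - s.length - 1) c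
  | n + 1 =>
    if n + 1 ≤ m then s ++ List.replicate (k m - s.length - 1) c
    else padSeq k c s m n ++ 1 :: List.replicate (k (n + 1) - k n - 1) c

/-- `δ_n := min {3d_i - d_{i-1} : k_{n-1} + 1 ≤ i ≤ k_n - 1}` (as an element of `EReal`,
so that `min ∅ = ⊤ = ∞`). -/
noncomputable def deltaMin (a : ℕ → ℝ) (k : ℕ → ℕ) (n : ℕ) : EReal :=
  sInf ((fun i => ((3 * dSeq a i - dSeq a (i - 1) : ℝ) : EReal)) ''
    (Set.Icc (k (n - 1) + 1) (k n - 1)))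

/-- `Δ_n := max {3d_i - d_{i-1} : k_{n-1} + 1 ≤ i ≤ k_n - 1}` (`max ∅ = ⊥ = -∞`). -/
noncomputable def deltaMax (a : ℕ → ℝ) (k : ℕ → ℕ) (n : ℕ) : EReal :=
  sSup ((fun i => ((3 * dSeq a i - dSeq a (i - 1) : ℝ) : EReal)) ''
    (Set.Icc (k (n - 1) + 1) (k n - 1)))

/-- `m_n := min { δ_n - (d_{k_n - 1} - d_{k_n}), 4 d_{k_n} - Δ_n }`. -/
noncomputable def mSeq (a : ℕ → ℝ) (k : ℕ → ℕ) (n : ℕ) : EReal :=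
  min (deltaMin a k n - ((dSeq a (k n - 1) - dSeq a (k n) : ℝ) : EReal))
    (((4 * dSeq a (k n) : ℝ) : EReal) - deltaMax a k n)

/-- `∑_{i=n+1}^∞ (d_{k_i - 1} - d_{k_i})`. -/
noncomputable def tailSum (a : ℕ → ℝ) (k : ℕ → ℕ) (n : ℕ) : ℝ :=
  ∑' i : ℕ, (dSeq a (k (n + 1 + i) - 1) - dSeq a (k (n + 1 + i)))

/-- Condition `(*)`: `m_n ≥ 2 ∑_{i=n+1}^∞ (d_{k_i - 1} - d_{k_i})` for every `n ∈ ℕ`. -/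
def condStar (a : ℕ → ℝ) (k : ℕ → ℕ) : Prop :=
  ∀ n : ℕ, 1 ≤ n → ((2 * tailSum a k n : ℝ) : EReal) ≤ mSeq a k n

/-- `(k_n)_{n ≥ 1}` is the increasing enumeration of all indices greater than `k 0 = k₀`
at which `a` exceeds `1/3`. -/
def IsGapEnum (a : ℕ → ℝ) (k : ℕ → ℕ) : Prop :=
  StrictMono k ∧ (∀ n, 1 ≤ n → k 0 < k n ∧ 1 / 3 < a (k n)) ∧
    (∀ j, k 0 < j → 1 / 3 < a j → ∃ n, 1 ≤ n ∧ k n = j)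

/-- `G` is a gap of `E`: a bounded connected component of `ℝ ∖ E`. -/
def IsGapOf (E G : Set ℝ) : Prop :=
  (∃ x ∉ E, G = connectedComponentIn Eᶜ x) ∧ Bornology.IsBounded G

/-- `C` is a proper (nontrivial) connected component of `E`. -/
def IsProperComponentOf (E C : Set ℝ) : Prop :=
  (∃ x ∈ E, C = connectedComponentIn E x) ∧ C.Nontrivial

/-- `E` is a Cantorval: a perfect set with infinitely many gaps such that both endpoints
of every gap are accumulated both by gaps and by proper components of `E`. -/
def IsCantorval (E : Set ℝ) : Prop :=
  Perfect E ∧ {G : Set ℝ | IsGapOf E G}.Infinite ∧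
    ∀ G, IsGapOf E G → ∀ p, p = sInf G ∨ p = sSup G →
      (∀ ε > 0, ∃ G', IsGapOf E G' ∧ G' ≠ G ∧ G' ⊆ Set.Ioo (p - ε) (p + ε)) ∧
      (∀ ε > 0, ∃ C, IsProperComponentOf E C ∧ C ⊆ Set.Ioo (p - ε) (p + ε))

/-- `J_s` and `J_u` (of length `k_m - 1`) are associated:
`N := N(0,s) = N(1,u) ∈ {k_{m-1}+1, …, k_m - 1}`, `s|(N-1) = u|(N-1)`, `u_N = s_N - 1`.
Then `J_u` is the interval covering `𝒢^0_s` and `J_s` is the interval covering `𝒢^1_u`. -/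
def Associated (k : ℕ → ℕ) (m : ℕ) (s u : List ℕ) : Prop :=
  s.length = k m - 1 ∧ u.length = k m - 1 ∧
    Nidx 0 s = Nidx 1 u ∧
    k (m - 1) + 1 ≤ Nidx 0 s ∧ Nidx 0 s ≤ k m - 1 ∧
    s.take (Nidx 0 s - 1) = u.take (Nidx 0 s - 1) ∧
    u.getD (Nidx 0 s - 1) 0 = s.getD (Nidx 0 s - 1) 0 - 1

/-- `G^i_g ⊂_* J_v`: the gap `G^i_g` is covered by the interval `J_v`, i.e. `G^i_g`
belongs to a family `𝒢^0_w` (resp. `𝒢^1_w`) such that `J_v` is the interval covering it. -/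
def CoversGap (k : ℕ → ℕ) (i : ℕ) (g : List ℕ) (v : List ℕ) : Prop :=
  ∃ m w, 1 ≤ m ∧
    ((Associated k m w v ∧ (i, g) ∈ gapFamilyAll k 0 w m) ∨
      (Associated k m v w ∧ (i, g) ∈ gapFamilyAll k 1 w m))

/-- The achievement set `E(x) = {∑_{j ∈ A} x_j : A ⊆ ℕ}` of a series (indexed from `1`). -/
def achievementSet (x : ℕ → ℝ) : Set ℝ :=
  {y | ∃ A : Set ℕ, A ⊆ {n | 1 ≤ n} ∧ HasSum (A.indicator x) y}

/-! ### Helper sets -/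

/-- Truncated one-sided gap set starting at level `j` with `f` levels. -/
def As (d : ℕ → ℝ) (g : ℕ → Prop) : ℕ → ℕ → Set ℝ
  | 0, _ => ∅
  | f + 1, j => {z | z ∈ As d g f (j + 1) ∨ (g (j + 1) ∧
      (2 * d (j + 1) - z ∈ As d g f (j + 1) ∨ (2 * d (j + 1) < z ∧ z < d j - d (j + 1)) ∨
        z - (d j - d (j + 1)) ∈ As d g f (j + 1)))}

/-- Truncated difference set. -/
def Rs (d : ℕ → ℝ) : ℕ → ℕ → Set ℝ
  | 0, j => Set.Icc 0 (2 * d j)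
  | f + 1, j => {z | z ∈ Rs d f (j + 1) ∨ z - (d j - d (j + 1)) ∈ Rs d f (j + 1) ∨
      z - 2 * (d j - d (j + 1)) ∈ Rs d f (j + 1)}

/-- Truncated Cantor set. -/
def Ks (d : ℕ → ℝ) : ℕ → ℕ → Set ℝ
  | 0, j => Set.Icc 0 (d j)
  | f + 1, j => {z | z ∈ Ks d f (j + 1) ∨ z - (d j - d (j + 1)) ∈ Ks d f (j + 1)}

/-- One-sided gaps by relative rank. -/
def Bs (d : ℕ → ℝ) (k : ℕ → ℕ) : ℕ → ℕ → Set ℝ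
  | 0, m => Set.Ioo (2 * d (k m)) (d (k m - 1) - d (k m))
  | r + 1, m => {z | z ∈ Bs d k r (m + 1) ∨ 2 * d (k m) - z ∈ Bs d k r (m + 1) ∨
      z - (d (k m - 1) - d (k m)) ∈ Bs d k r (m + 1)}

section abstractD

variable {d : ℕ → ℝ} {g : ℕ → Prop}

theorem As_bound (hp : ∀ n, 0 < d n) (hh : ∀ n, d (n + 1) < d n / 2)
    (hg : ∀ n, g (n + 1) → 2 * d (n + 1) < d n - d (n + 1)) :
    ∀ f j z, z ∈ As d g f j → 0 < z ∧ z < d j := by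
  intro f
  induction f with
  | zero => intro j z h; exact absurd h (by simp [As])
  | succ f ih =>
    intro j z h
    have h1 := hp (j + 1)
    have h2 := hh j
    rcases h with h | ⟨hgj, h | h | h⟩
    · have := ih _ _ h; constructor <;> linarith
    · have := ih _ _ h; have := hg j hgj; constructor <;> linarith
    · constructor <;> linarith [h.1, h.2]
    · have := ih _ _ h; constructor <;> linarith

theorem As_bound2 (q : ℕ) (T : ℝ) (hq2 : 2 * d q < d (q - 1) - d q)
    (hA : ∀ f z, z ∈ As d g f q → 0 < z ∧ z < T) (hT : 0 ≤ T) :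
    ∀ f j z, j < q → (∀ i, j < i → i < q → ¬ g i) → z ∈ As d g f j →
      (0 < z ∧ z < T) ∨
        (2 * d q - T < z ∧ z < d (q - 1) - d q + T) := by
  intro f
  induction f with
  | zero => intro j z _ _ h; exact absurd h (by simp [As])
  | succ f ih =>
    intro j z hj hno h
    by_cases hq : j + 1 = q
    · subst hq
      simp only [Nat.add_sub_cancel] at *
      rcases h with h | ⟨hgj, h | h | h⟩
      · exact Or.inl (hA _ _ h)
      · have h1 := hA _ _ h
        right; constructor <;> linarith [h1.1, h1.2]
      · right; constructor <;> linarith [h.1, h.2]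
      · have h1 := hA _ _ h
        right; constructor <;> linarith [h1.1, h1.2]
    · rcases h with h | ⟨hgj, -⟩
      · exact ih (j + 1) z (by omega) (fun i h1 h2 => hno i (by omega) h2) h
      · exact absurd hgj (hno _ (by omega) (by omega))

/-- The quantitative consequence of condition `(*)`. -/
def HypStar (d : ℕ → ℝ) (g : ℕ → Prop) : Prop :=
  ∀ j, ¬ g (j + 1) → ∃ q T, j + 1 < q ∧ 2 * d q < d (q - 1) - d q ∧
    (∀ i, j < i → i < q → ¬ g i) ∧ 0 ≤ T ∧
    (∀ f z, z ∈ As d g f q → 0 < z ∧ z < T) ∧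
    2 * T ≤ (3 * d (j + 1) - d j) - (d (q - 1) - d q) ∧
    2 * T ≤ 4 * d q - (3 * d (j + 1) - d j)

theorem nongap_key (hp : ∀ n, 0 < d n) (hh : ∀ n, d (n + 1) < d n / 2)
    (hg : ∀ n, g (n + 1) → 2 * d (n + 1) < d n - d (n + 1))
    (H : HypStar d g) (j f : ℕ) (hj : ¬ g (j + 1)) (z : ℝ) (hz : z ∈ As d g f (j + 1)) :
    0 < z ∧ z < d (j + 1) ∧ z < 3 * d (j + 1) - d j ∧
      z + (d j - d (j + 1)) ∉ As d g f (j + 1) ∧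
      3 * d (j + 1) - d j - z ∉ As d g f (j + 1) := by
  obtain ⟨q, T, hq, hq2, hno, hT, hA, h1, h2⟩ := H j hj
  have b := As_bound hp hh hg f (j + 1)
  have b2 := fun z => As_bound2 q T hq2 hA hT f (j + 1) z hq (fun i h1 h2 => hno i (by omega) h2)
  have := hh j
  have hpj := hp (j + 1)
  have hz1 := b z hz
  have hpq := hp q
  refine ⟨hz1.1, hz1.2, ?_, ?_, ?_⟩
  · rcases b2 z hz with h | h <;> linarith [h.1, h.2]
  · intro h; have := b _ h; linarith [this.1, this.2]
  · intro h
    rcases b2 z hz with h3 | h3 <;> rcases b2 _ h with h4 | h4 <;>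
      linarith [h3.1, h3.2, h4.1, h4.2]

theorem Rs_eq (hp : ∀ n, 0 < d n) (hh : ∀ n, d (n + 1) < d n / 2)
    (hg : ∀ n, g (n + 1) → 2 * d (n + 1) < d n - d (n + 1))
    (H : HypStar d g) :
    ∀ f j z, z ∈ Rs d f j ↔
      0 ≤ z ∧ z ≤ 2 * d j ∧ z ∉ As d g f j ∧ 2 * d j - z ∉ As d g f j := by
  intro f
  induction f with
  | zero => intro j z; simp [Rs, As]
  | succ f ih =>
    intro j z
    have hB := As_bound hp hh hg f (j + 1)
    have hpj := hp (j + 1)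
    have hhj := hh j
    have e1 : ∀ w, 2 * d (j + 1) - (w - (d j - d (j + 1))) = d j + d (j + 1) - w := by
      intro w; ring
    have e2 : ∀ w, 2 * d (j + 1) - (w - 2 * (d j - d (j + 1))) = 2 * d j - w := by
      intro w; ring
    by_cases hgj : g (j + 1)
    · have hgap := hg j hgj
      have e3 : 2 * d (j + 1) - (2 * d j - z) = z - 2 * (d j - d (j + 1)) := by ring
      have e4 : 2 * d j - z - (d j - d (j + 1)) = d j + d (j + 1) - z := by ring
      simp only [Rs, As, Set.mem_ofPred_eq, ih, hgj, true_and, e1, e2, e3, e4]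
      constructor
      · rintro (⟨p1, p2, p3, p4⟩ | ⟨p1, p2, p3, p4⟩ | ⟨p1, p2, p3, p4⟩)
        · refine ⟨p1, by linarith, ?_, ?_⟩
          · rintro (h | h | h | h)
            · exact p3 h
            · exact p4 h
            · linarith [h.1]
            · linarith [(hB _ h).1]
          · rintro (h | h | h | h)
            · linarith [(hB _ h).2]
            · linarith [(hB _ h).1]
            · linarith [h.2]
            · linarith [(hB _ h).2]
        · refine ⟨by linarith, by linarith, ?_, ?_⟩
          · rintro (h | h | h | h)
            · linarith [(hB _ h).2]
            · linarith [(hB _ h).1]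
            · linarith [h.2]
            · exact p3 h
          · rintro (h | h | h | h)
            · linarith [(hB _ h).2]
            · linarith [(hB _ h).1]
            · linarith [h.2]
            · exact p4 h
        · refine ⟨by linarith, by linarith, ?_, ?_⟩
          · rintro (h | h | h | h)
            · linarith [(hB _ h).2]
            · linarith [(hB _ h).1]
            · linarith [h.2]
            · linarith [(hB _ h).2]
          · rintro (h | h | h | h)
            · exact p4 h
            · exact p3 h
            · linarith [h.1]
            · linarith [(hB _ h).1]
      · rintro ⟨p1, p2, p3, p4⟩
        push Not at p3 p4
        obtain ⟨a1, a2, a3, a4⟩ := p3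
        obtain ⟨b1, b2, b3, b4⟩ := p4
        by_cases c1 : z ≤ 2 * d (j + 1)
        · exact Or.inl ⟨p1, c1, a1, a2⟩
        · have c2 := a3 (by linarith)
          by_cases c3 : z ≤ d j + d (j + 1)
          · exact Or.inr (Or.inl ⟨by linarith, by linarith, a4, b4⟩)
          · by_cases c4 : 2 * d (j + 1) < 2 * d j - z
            · have := b3 c4; linarith
            · exact Or.inr (Or.inr ⟨by linarith, by linarith, b2, b1⟩)
    · have key := nongap_key hp hh hg H j f hgj
      simp only [Rs, As, Set.mem_ofPred_eq, ih, hgj, false_and, or_false, e1, e2]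
      have ov : 0 ≤ 3 * d (j + 1) - d j := by
        obtain ⟨q, T, hq, hq2, hno, hT, hA, h1, h2⟩ := H j hgj
        linarith [hp q]
      constructor
      · rintro (⟨p1, p2, p3, p4⟩ | ⟨p1, p2, p3, p4⟩ | ⟨p1, p2, p3, p4⟩)
        · refine ⟨p1, by linarith, p3, ?_⟩
          intro h; linarith [(hB _ h).2]
        · refine ⟨by linarith, by linarith, ?_, ?_⟩
          · intro h; linarith [(hB _ h).2]
          · intro h; linarith [(hB _ h).2]
        · refine ⟨by linarith, by linarith, ?_, p4⟩
          intro h; linarith [(hB _ h).2]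
      · rintro ⟨p1, p2, p3, p4⟩
        -- if in copy `c`, then in some truncated copy
        by_cases c1 : z ≤ 2 * d (j + 1)
        · by_cases c2 : 2 * d (j + 1) - z ∈ As d g f (j + 1)
          · obtain ⟨k1, k2, k3, k4, k5⟩ := key _ c2
            refine Or.inr (Or.inl ⟨by linarith, by linarith, ?_, ?_⟩)
            · convert k5 using 1; ring_nf
            · convert k4 using 1; ring_nf
          · exact Or.inl ⟨p1, c1, p3, c2⟩
        · by_cases c3 : z ≤ d j + d (j + 1)
          · by_cases c4 : z - (d j - d (j + 1)) ∈ As d g f (j + 1)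
            · obtain ⟨k1, k2, k3, k4, k5⟩ := key _ c4
              exfalso; linarith
            · by_cases c5 : d j + d (j + 1) - z ∈ As d g f (j + 1)
              · obtain ⟨k1, k2, k3, k4, k5⟩ := key _ c5
                refine Or.inr (Or.inr ⟨by linarith, by linarith, ?_, p4⟩)
                convert k5 using 1; ring_nf
              · exact Or.inr (Or.inl ⟨by linarith, by linarith, c4, c5⟩)
          · by_cases c4 : z - 2 * (d j - d (j + 1)) ∈ As d g f (j + 1)
            · obtain ⟨k1, k2, k3, k4, k5⟩ := key _ c4
              exfalso; linarith
            · exact Or.inr (Or.inr ⟨by linarith, by linarith, c4, p4⟩)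

theorem Ks_bound (hp : ∀ n, 0 < d n) (hh : ∀ n, d (n + 1) < d n / 2) :
    ∀ f j, Ks d f j ⊆ Set.Icc 0 (d j) := by
  intro f
  induction f with
  | zero => intro j; exact subset_rfl
  | succ f ih =>
    intro j z h
    have := hp (j + 1); have := hh j
    rcases h with h | h <;> have := ih _ h <;> constructor <;> linarith [this.1, this.2]

theorem Ks_anti (hp : ∀ n, 0 < d n) (hh : ∀ n, d (n + 1) < d n / 2) :
    ∀ f j, Ks d (f + 1) j ⊆ Ks d f j := by
  intro f
  induction f with
  | zero => intro j; exact Ks_bound hp hh 1 j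
  | succ f ih =>
    intro j z h
    rcases h with h | h
    · exact Or.inl (ih _ h)
    · exact Or.inr (ih _ h)

theorem Ks_compact : ∀ f j, IsCompact (Ks d f j) := by
  intro f
  induction f with
  | zero => intro j; exact isCompact_Icc
  | succ f ih =>
    intro j
    have h2 := (ih (j + 1)).image (f := fun z => z + (d j - d (j + 1))) (by fun_prop)
    have : Ks d (f + 1) j = Ks d f (j + 1) ∪
        (fun z => z + (d j - d (j + 1))) '' (Ks d f (j + 1)) := by
      ext z
      simp only [Ks, Set.mem_ofPred_eq, Set.mem_union, Set.mem_image]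
      refine or_congr Iff.rfl ⟨fun h => ⟨_, h, by ring⟩, ?_⟩
      rintro ⟨w, hw, rfl⟩
      simpa using hw
    rw [this]
    exact (ih _).union h2

theorem Ks_diff (hp : ∀ n, 0 < d n) :
    ∀ f j z, z ∈ Rs d f j ↔ ∃ p ∈ Ks d f j, ∃ q ∈ Ks d f j, z = p - q + d j := by
  intro f
  induction f with
  | zero =>
    intro j z
    simp only [Rs, Ks]
    constructor
    · rintro ⟨h1, h2⟩
      have := hp j
      by_cases h : z ≤ d j
      · exact ⟨0, ⟨le_rfl, this.le⟩, d j - z, ⟨by linarith, by linarith⟩, by ring⟩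
      · exact ⟨z - d j, ⟨by linarith, by linarith⟩, 0, ⟨le_rfl, this.le⟩, by ring⟩
    · rintro ⟨p, ⟨h1, h2⟩, q, ⟨h3, h4⟩, rfl⟩
      constructor <;> linarith
  | succ f ih =>
    intro j z
    simp only [Rs, Set.mem_ofPred_eq, ih]
    constructor
    · rintro (⟨p, hp1, q, hq, h⟩ | ⟨p, hp1, q, hq, h⟩ | ⟨p, hp1, q, hq, h⟩)
      · refine ⟨p, Or.inl hp1, q + (d j - d (j + 1)), Or.inr (by simpa using hq), by linarith⟩
      · refine ⟨p, Or.inl hp1, q, Or.inl hq, by linarith⟩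
      · refine ⟨p + (d j - d (j + 1)), Or.inr (by simpa using hp1), q, Or.inl hq, by linarith⟩
    · rintro ⟨p, hp1 | hp1, q, hq | hq, rfl⟩
      · exact Or.inr (Or.inl ⟨p, hp1, q, hq, by ring⟩)
      · exact Or.inl ⟨p, hp1, _, hq, by ring⟩
      · exact Or.inr (Or.inr ⟨_, hp1, q, hq, by ring⟩)
      · exact Or.inr (Or.inl ⟨_, hp1, _, hq, by ring⟩)

theorem inter_diff (hp : ∀ n, 0 < d n) (hh : ∀ n, d (n + 1) < d n / 2) (y : ℝ) :
    y ∈ (⋂ f, Ks d f 0) - (⋂ f, Ks d f 0) ↔ ∀ f, y + d 0 ∈ Rs d f 0 := by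
  constructor
  · rintro h f
    obtain ⟨p, hp1, q, hq, rfl⟩ := Set.mem_sub.1 h
    rw [Set.mem_iInter] at hp1 hq
    exact (Ks_diff hp f 0 _).2 ⟨p, hp1 f, q, hq f, rfl⟩
  · intro h
    let S : ℕ → Set ℝ := fun f => Ks d f 0 ∩ (fun p => p - y) ⁻¹' (Ks d f 0)
    have hcl : ∀ f, IsClosed ((fun p => p - y) ⁻¹' (Ks d f 0)) := fun f =>
      (Ks_compact f 0).isClosed.preimage (by fun_prop)
    have := IsCompact.nonempty_iInter_of_sequence_nonempty_isCompact_isClosed S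
      (fun f => Set.inter_subset_inter (Ks_anti hp hh f 0)
        (Set.preimage_mono (Ks_anti hp hh f 0)))
      (fun f => by
        obtain ⟨p, hp1, q, hq, e⟩ := (Ks_diff hp f 0 _).1 (h f)
        refine ⟨p, hp1, ?_⟩
        have : p - y = q := by linarith
        simpa [this] using hq)
      ((Ks_compact 0 0).inter_right (hcl 0))
      (fun f => (Ks_compact f 0).isClosed.inter (hcl f))
    obtain ⟨p, hp1⟩ := this
    rw [Set.mem_iInter] at hp1
    exact Set.mem_sub.2 ⟨p, Set.mem_iInter.2 fun f => (hp1 f).1, p - y,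
      Set.mem_iInter.2 fun f => (hp1 f).2, by ring⟩

end abstractD

section rankB

variable {d : ℕ → ℝ} {g : ℕ → Prop} {k : ℕ → ℕ}

theorem As_skip : ∀ p j f z, z ∈ As d g f (j + p) → z ∈ As d g (f + p) j := by
  intro p
  induction p with
  | zero => intro j f z h; exact h
  | succ p ih =>
    intro j f z h
    refine Or.inl (ih (j + 1) f z ?_)
    have : j + 1 + p = j + (p + 1) := by ring
    rwa [this]

theorem Bs_to_As (hk : StrictMono k) (hk1 : ∀ m, 1 ≤ m → 1 ≤ k m)
    (hgk : ∀ m, 1 ≤ m → g (k m)) :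
    ∀ r m z, 1 ≤ m → z ∈ Bs d k r m → ∃ f, z ∈ As d g f (k m - 1) := by
  intro r
  induction r with
  | zero =>
    intro m z hm h
    refine ⟨1, Or.inr ?_⟩
    have := hk1 m hm
    rw [Nat.sub_add_cancel this]
    exact ⟨hgk m hm, Or.inr (Or.inl h)⟩
  | succ r ih =>
    intro m z hm h
    have h1 := hk1 m hm
    have key : ∀ w, w ∈ Bs d k r (m + 1) → ∃ f, w ∈ As d g f (k m) := by
      intro w hw
      obtain ⟨f, hf⟩ := ih (m + 1) w (by omega) hw
      have hlt := hk (Nat.lt_succ_self m)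
      refine ⟨f + (k (m + 1) - 1 - k m), As_skip _ _ _ _ ?_⟩
      have : k m + (k (m + 1) - 1 - k m) = k (m + 1) - 1 := by
        simp only [Nat.succ_eq_add_one] at hlt; omega
      rwa [this]
    have e : k m - 1 + 1 = k m := Nat.sub_add_cancel h1
    rcases h with h | h | h
    · obtain ⟨f, hf⟩ := key _ h
      refine ⟨f + 1, Or.inl ?_⟩
      rwa [e]
    · obtain ⟨f, hf⟩ := key _ h
      refine ⟨f + 1, Or.inr ?_⟩
      rw [e]
      exact ⟨hgk m hm, Or.inl hf⟩
    · obtain ⟨f, hf⟩ := key _ h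
      refine ⟨f + 1, Or.inr ?_⟩
      rw [e]
      exact ⟨hgk m hm, Or.inr (Or.inr hf)⟩

theorem As_to_Bs (hk : StrictMono k) (hgk' : ∀ j, 1 ≤ j → g j → ∃ n, 1 ≤ n ∧ k n = j) :
    ∀ f j m z, 1 ≤ m → k (m - 1) ≤ j → j < k m → z ∈ As d g f j → ∃ r, z ∈ Bs d k r m := by
  intro f
  induction f with
  | zero => intro j m z _ _ _ h; exact absurd h (by simp [As])
  | succ f ih =>
    intro j m z hm h1 h2 h
    by_cases hj : j + 1 = k m
    · have e : k m - 1 = j := by omega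
      have hlt := hk (Nat.lt_succ_self m)
      have key : ∀ w, w ∈ As d g f (j + 1) → ∃ r, w ∈ Bs d k r (m + 1) := by
        intro w hw
        exact ih (j + 1) (m + 1) w (by omega) (by simp [hj]) (by rw [hj]; exact hlt) hw
      rcases h with h | ⟨-, h | h | h⟩
      · obtain ⟨r, hr⟩ := key _ h
        exact ⟨r + 1, Or.inl hr⟩
      · obtain ⟨r, hr⟩ := key _ h
        refine ⟨r + 1, Or.inr (Or.inl ?_)⟩
        rwa [← hj]
      · refine ⟨0, ?_⟩
        simp only [Bs]
        rw [← hj]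
        exact h
      · obtain ⟨r, hr⟩ := key _ h
        refine ⟨r + 1, Or.inr (Or.inr ?_)⟩
        rw [← hj]
        exact hr
    · rcases h with h | ⟨hgj, -⟩
      · exact ih (j + 1) m z hm (by omega) (by omega) h
      · exfalso
        obtain ⟨n, hn, e⟩ := hgk' (j + 1) (by omega) hgj
        have a1 : k (m - 1) < k n := by omega
        have a2 : k n < k m := by omega
        rw [hk.lt_iff_lt] at a1 a2
        omega

theorem Bs_bound (hp : ∀ n, 0 < d n) (hh : ∀ n, d (n + 1) < d n / 2)
    (hk : StrictMono k) (hk1 : ∀ m, 1 ≤ m → 1 ≤ k m)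
    (hgk : ∀ m, 1 ≤ m → 2 * d (k m) < d (k m - 1) - d (k m)) :
    ∀ r m z, 1 ≤ m → z ∈ Bs d k r m → 0 < z ∧ z < d (k m - 1) := by
  intro r m z hm hz
  obtain ⟨f, hf⟩ := Bs_to_As (g := fun j => ∃ n, 1 ≤ n ∧ k n = j) hk hk1
    (fun m hm => ⟨m, hm, rfl⟩) r m z hm hz
  refine As_bound hp hh ?_ f _ z hf
  rintro n ⟨l, hl, e⟩
  have := hgk l hl
  rw [e] at this
  exact this

theorem d_anti (hp : ∀ n, 0 < d n) (hh : ∀ n, d (n + 1) < d n / 2) : Antitone d :=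
  antitone_nat_of_succ_le fun n => by linarith [hp n, hh n]

theorem Bs_bound' (hp : ∀ n, 0 < d n) (hh : ∀ n, d (n + 1) < d n / 2)
    (hk : StrictMono k) (hk1 : ∀ m, 1 ≤ m → 1 ≤ k m)
    (hgk : ∀ m, 1 ≤ m → 2 * d (k m) < d (k m - 1) - d (k m)) :
    ∀ r m z, 1 ≤ m → z ∈ Bs d k r (m + 1) → 0 < z ∧ z < d (k m) := by
  intro r m z hm hz
  have := Bs_bound hp hh hk hk1 hgk r (m + 1) z (by omega) hz
  have hlt : k m < k (m + 1) := hk (Nat.lt_succ_self m)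
  exact ⟨this.1, this.2.trans_le (d_anti hp hh (by omega))⟩

theorem Bs_open : ∀ r m, IsOpen (Bs d k r m) := by
  intro r
  induction r with
  | zero => intro m; exact isOpen_Ioo
  | succ r ih =>
    intro m
    have h2 := (ih (m + 1)).preimage (f := fun z => 2 * d (k m) - z) (by fun_prop)
    have h3 := (ih (m + 1)).preimage (f := fun z => z - (d (k m - 1) - d (k m))) (by fun_prop)
    exact (ih (m + 1)).union (h2.union h3)

theorem Bs_vol (hp : ∀ n, 0 < d n) (hh : ∀ n, d (n + 1) < d n / 2)
    (hk : StrictMono k) (hk1 : ∀ m, 1 ≤ m → 1 ≤ k m)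
    (hgk : ∀ m, 1 ≤ m → 2 * d (k m) < d (k m - 1) - d (k m)) :
    ∀ r m, 1 ≤ m → volume (Bs d k r m) =
      ENNReal.ofReal (3 ^ r * (d (k (m + r) - 1) - 3 * d (k (m + r)))) := by
  intro r
  induction r with
  | zero =>
    intro m hm
    simp only [Bs, Real.volume_Ioo, pow_zero, one_mul, add_zero]
    congr 1; ring
  | succ r ih =>
    intro m hm
    have hb := Bs_bound' hp hh hk hk1 hgk r m
    have hpk := hp (k m)
    have hgm := hgk m hm
    have e : Bs d k (r + 1) m = Bs d k r (m + 1) ∪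
        ((fun z => 2 * d (k m) - z) ⁻¹' Bs d k r (m + 1) ∪
          (fun z => z - (d (k m - 1) - d (k m))) ⁻¹' Bs d k r (m + 1)) := rfl
    have o2 := (Bs_open (d := d) (k := k) r (m + 1)).preimage
      (f := fun z => 2 * d (k m) - z) (by fun_prop)
    have o3 := (Bs_open (d := d) (k := k) r (m + 1)).preimage
      (f := fun z => z - (d (k m - 1) - d (k m))) (by fun_prop)
    have v2 : volume ((fun z => 2 * d (k m) - z) ⁻¹' Bs d k r (m + 1)) =
        volume (Bs d k r (m + 1)) :=
      (Measure.measurePreserving_sub_left volume (2 * d (k m))).measure_preimage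
        (Bs_open r (m + 1)).measurableSet.nullMeasurableSet
    have v3 : volume ((fun z => z - (d (k m - 1) - d (k m))) ⁻¹' Bs d k r (m + 1)) =
        volume (Bs d k r (m + 1)) :=
      (measurePreserving_sub_right volume (d (k m - 1) - d (k m))).measure_preimage
        (Bs_open r (m + 1)).measurableSet.nullMeasurableSet
    rw [e, measure_union _ (o2.union o3).measurableSet, measure_union _ o3.measurableSet, v2, v3,
      ih (m + 1) (by omega)]
    · have h0 : 0 ≤ 3 ^ r * (d (k (m + 1 + r) - 1) - 3 * d (k (m + 1 + r))) := by
        have := hgk (m + 1 + r) (by omega)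
        have : 0 ≤ d (k (m + 1 + r) - 1) - 3 * d (k (m + 1 + r)) := by linarith
        positivity
      rw [← ENNReal.ofReal_add h0 h0, ← ENNReal.ofReal_add h0 (by linarith)]
      have : m + (r + 1) = m + 1 + r := by ring
      rw [this]
      congr 1; ring
    · rw [Set.disjoint_left]
      intro z h1 h2
      have h3 := hb _ hm h1
      have h4 := hb _ hm h2
      linarith [h3.1, h3.2, h4.1, h4.2]
    · rw [Set.disjoint_left]
      rintro z h1 (h2 | h2) <;>
      · have h3 := hb _ hm h1
        have h4 := hb _ hm h2
        linarith [h3.1, h3.2, h4.1, h4.2]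

theorem Bs_disj (hp : ∀ n, 0 < d n) (hh : ∀ n, d (n + 1) < d n / 2)
    (hk : StrictMono k) (hk1 : ∀ m, 1 ≤ m → 1 ≤ k m)
    (hgk : ∀ m, 1 ≤ m → 2 * d (k m) < d (k m - 1) - d (k m)) :
    ∀ r r' m z, 1 ≤ m → r < r' → z ∈ Bs d k r m → z ∉ Bs d k r' m := by
  intro r
  induction r with
  | zero =>
    intro r' m z hm hr h1 h2
    obtain ⟨r', rfl⟩ : ∃ q, r' = q + 1 := ⟨r' - 1, by omega⟩
    have hb := Bs_bound' hp hh hk hk1 hgk r' m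
    have hpk := hp (k m)
    rcases h2 with h2 | h2 | h2 <;>
    · have h3 := hb _ hm h2
      linarith [h3.1, h3.2, h1.1, h1.2]
  | succ r ih =>
    intro r' m z hm hr h1 h2
    obtain ⟨r', rfl⟩ : ∃ q, r' = q + 1 := ⟨r' - 1, by omega⟩
    have hb := Bs_bound' hp hh hk hk1 hgk r m
    have hb' := Bs_bound' hp hh hk hk1 hgk r' m
    have hpk := hp (k m)
    have hgm := hgk m hm
    rcases h1 with h1 | h1 | h1 <;> rcases h2 with h2 | h2 | h2 <;>
    first
    | exact ih r' (m + 1) _ (by omega) (by omega) h1 h2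
    | (have h3 := hb _ hm h1
       have h4 := hb' _ hm h2
       linarith [h3.1, h3.2, h4.1, h4.2])

theorem Bs_union_vol (hp : ∀ n, 0 < d n) (hh : ∀ n, d (n + 1) < d n / 2)
    (hk : StrictMono k) (hk1 : ∀ m, 1 ≤ m → 1 ≤ k m)
    (hgk : ∀ m, 1 ≤ m → 2 * d (k m) < d (k m - 1) - d (k m)) :
    volume (⋃ r, Bs d k r 1) =
      ENNReal.ofReal (∑' r : ℕ, (3 : ℝ) ^ r * (d (k (r + 1) - 1) - 3 * d (k (r + 1)))) := by
  have hle : volume (⋃ r, Bs d k r 1) ≠ ⊤ := by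
    have : volume (⋃ r, Bs d k r 1) ≤ volume (Set.Ioo 0 (d (k 1 - 1))) := by
      refine measure_mono (Set.iUnion_subset fun r z hz => ?_)
      exact Bs_bound hp hh hk hk1 hgk r 1 z le_rfl hz
    refine ne_top_of_le_ne_top ?_ this
    simp
  have e : volume (⋃ r, Bs d k r 1) =
      ∑' r : ℕ, ENNReal.ofReal ((3 : ℝ) ^ r * (d (k (r + 1) - 1) - 3 * d (k (r + 1)))) := by
    rw [measure_iUnion _ fun r => (Bs_open r 1).measurableSet]
    · refine tsum_congr fun r => ?_
      rw [Bs_vol hp hh hk hk1 hgk r 1 le_rfl, add_comm 1 r]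
    · intro r r' hne
      refine Set.disjoint_left.2 fun z h1 h2 => ?_
      rcases lt_or_gt_of_ne hne with h | h
      · exact Bs_disj hp hh hk hk1 hgk r r' 1 z le_rfl h h1 h2
      · exact Bs_disj hp hh hk hk1 hgk r' r 1 z le_rfl h h2 h1
  have h0 : ∀ r : ℕ, 0 ≤ (3 : ℝ) ^ r * (d (k (r + 1) - 1) - 3 * d (k (r + 1))) := by
    intro r
    have := hgk (r + 1) (by omega)
    have : 0 ≤ d (k (r + 1) - 1) - 3 * d (k (r + 1)) := by linarith
    positivity
  rw [e] at hle ⊢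
  rw [ENNReal.ofReal_tsum_of_nonneg h0]
  have := ENNReal.summable_toReal hle
  refine this.congr fun r => ?_
  rw [ENNReal.toReal_ofReal (h0 r)]

end rankB

section lists

variable {a : ℕ → ℝ} {k : ℕ → ℕ}

theorem Jl_append (s : List ℕ) (c : ℕ) :
    Jl a (s ++ [c]) = Jl a s + (c : ℝ) * (dSeq a s.length - dSeq a (s.length + 1)) := by
  unfold Jl
  rw [List.length_append, List.length_singleton, Finset.sum_range_succ, ← add_assoc]
  congr 2
  · refine Finset.sum_congr rfl fun j hj => ?_
    rw [List.getD_append _ _ _ _ (Finset.mem_range.1 hj)]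
  · rw [List.getD_append_right _ _ _ _ le_rfl]
    simp

theorem Jl_rep0 (s : List ℕ) (n : ℕ) : Jl a (s ++ List.replicate n 0) = Jl a s := by
  induction n with
  | zero => simp
  | succ n ih =>
    rw [List.replicate_succ', ← List.append_assoc, Jl_append, ih]; simp

theorem Jr_append2 (s : List ℕ) : Jr a (s ++ [2]) = Jr a s := by
  unfold Jr
  rw [Jl_append, List.length_append, List.length_singleton]
  push_cast; ring

theorem Jr_rep2 (s : List ℕ) (n : ℕ) : Jr a (s ++ List.replicate n 2) = Jr a s := by
  induction n with
  | zero => simp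
  | succ n ih =>
    rw [List.replicate_succ', ← List.append_assoc, Jr_append2, ih]

theorem cons_split (s : List ℕ) (c e n : ℕ) :
    s ++ c :: List.replicate n e = (s ++ [c]) ++ List.replicate n e := by simp

theorem gapFamily_eq (i0 : ℕ) (s0 : List ℕ) (m n : ℕ) (h : m ≤ n) :
    gapFamily k i0 s0 m n =
      {(i0, s0 ++ List.replicate (k n - k m) (2 * i0))} ∪
      ⋃ (l : ℕ) (_ : m ≤ l) (_ : l < n),
        ⋃ p ∈ gapFamily k i0 s0 m l,
          ({(1, p.2 ++ p.1 :: List.replicate (k n - k l - 1) 2),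
            (0, p.2 ++ (p.1 + 1) :: List.replicate (k n - k l - 1) 0)} : Set (ℕ × List ℕ)) := by
  rw [gapFamily]
  split_ifs with h1
  · obtain rfl : n = m := le_antisymm h1 h
    have : ∀ l, n ≤ l → l < n → False := fun l h1 h2 => by omega
    ext p
    simp only [Set.mem_union, Set.mem_iUnion, Nat.sub_self, List.replicate_zero, List.append_nil]
    constructor
    · exact Or.inl
    · rintro (h | ⟨l, h1, h2, -⟩)
      · exact h
      · omega
  · rfl

theorem mem_gapFamily (i0 : ℕ) (s0 : List ℕ) (m n : ℕ) (h : m ≤ n) (p : ℕ × List ℕ) :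
    p ∈ gapFamily k i0 s0 m n ↔
      p = (i0, s0 ++ List.replicate (k n - k m) (2 * i0)) ∨
      ∃ l, m ≤ l ∧ l < n ∧ ∃ q ∈ gapFamily k i0 s0 m l,
        (p = (1, q.2 ++ q.1 :: List.replicate (k n - k l - 1) 2) ∨
          p = (0, q.2 ++ (q.1 + 1) :: List.replicate (k n - k l - 1) 0)) := by
  rw [gapFamily_eq i0 s0 m n h]
  simp only [Set.mem_union, Set.mem_iUnion, Set.mem_singleton_iff, Set.mem_insert_iff,
    exists_prop]

theorem rep_join (hk : StrictMono k) (s0 : List ℕ) (c e m n : ℕ) (h : m + 1 ≤ n) :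
    (s0 ++ c :: List.replicate (k (m + 1) - k m - 1) e) ++
      List.replicate (k n - k (m + 1)) e = s0 ++ c :: List.replicate (k n - k m - 1) e := by
  have h1 : k m < k (m + 1) := hk (Nat.lt_succ_self m)
  have h2 : k (m + 1) ≤ k n := hk.monotone h
  have : k n - k m - 1 = (k (m + 1) - k m - 1) + (k n - k (m + 1)) := by omega
  rw [this, List.replicate_add]
  simp

theorem rep_cons (hk : StrictMono k) (s0 : List ℕ) (c m n : ℕ) (h : m + 1 ≤ n) :
    s0 ++ List.replicate (k n - k m) c = s0 ++ c :: List.replicate (k n - k m - 1) c := by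
  have h1 : k m < k (m + 1) := hk (Nat.lt_succ_self m)
  have h2 : k (m + 1) ≤ k n := hk.monotone h
  have : k n - k m = (k n - k m - 1) + 1 := by omega
  conv_lhs => rw [this, List.replicate_succ]

theorem gapFamily_split (hk : StrictMono k) (i0 : ℕ) (s0 : List ℕ) (m : ℕ) :
    ∀ n, m + 1 ≤ n → ∀ p, p ∈ gapFamily k i0 s0 m n ↔
      p ∈ gapFamily k i0 (s0 ++ (2 * i0) :: List.replicate (k (m + 1) - k m - 1) (2 * i0))
          (m + 1) n ∨
      p ∈ gapFamily k 1 (s0 ++ i0 :: List.replicate (k (m + 1) - k m - 1) 2) (m + 1) n ∨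
      p ∈ gapFamily k 0 (s0 ++ (i0 + 1) :: List.replicate (k (m + 1) - k m - 1) 0) (m + 1) n := by
  intro n
  induction n using Nat.strong_induction_on with
  | _ n ih =>
  intro hn p
  rw [mem_gapFamily i0 s0 m n (by omega), mem_gapFamily i0 _ (m + 1) n hn,
    mem_gapFamily 1 _ (m + 1) n hn, mem_gapFamily 0 _ (m + 1) n hn]
  simp only [mul_one, mul_zero]
  rw [rep_join hk s0 _ _ m n hn, rep_join hk s0 _ _ m n hn, rep_join hk s0 _ _ m n hn,
    rep_cons hk s0 _ m n hn]
  have hm : ∀ q, q ∈ gapFamily k i0 s0 m m ↔ q = (i0, s0) := by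
    intro q; rw [gapFamily]; simp
  constructor
  · rintro (h | ⟨l, h1, h2, q, hq, h⟩)
    · exact Or.inl (Or.inl h)
    · rcases Nat.eq_or_lt_of_le h1 with rfl | h3
      · rw [hm] at hq
        subst hq
        rcases h with h | h
        · exact Or.inr (Or.inl (Or.inl h))
        · exact Or.inr (Or.inr (Or.inl h))
      · rw [ih l h2 h3] at hq
        rcases hq with hq | hq | hq
        · exact Or.inl (Or.inr ⟨l, h3, h2, q, hq, h⟩)
        · exact Or.inr (Or.inl (Or.inr ⟨l, h3, h2, q, hq, h⟩))
        · exact Or.inr (Or.inr (Or.inr ⟨l, h3, h2, q, hq, h⟩))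
  · rintro ((h | ⟨l, h1, h2, q, hq, h⟩) | (h | ⟨l, h1, h2, q, hq, h⟩) | (h | ⟨l, h1, h2, q, hq, h⟩))
    · exact Or.inl h
    · exact Or.inr ⟨l, by omega, h2, q, (ih l h2 h1 q).2 (Or.inl hq), h⟩
    · exact Or.inr ⟨m, le_rfl, by omega, (i0, s0), (hm _).2 rfl, Or.inl h⟩
    · exact Or.inr ⟨l, by omega, h2, q, (ih l h2 h1 q).2 (Or.inr (Or.inl hq)), h⟩
    · exact Or.inr ⟨m, le_rfl, by omega, (i0, s0), (hm _).2 rfl, Or.inr h⟩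
    · exact Or.inr ⟨l, by omega, h2, q, (ih l h2 h1 q).2 (Or.inr (Or.inr hq)), h⟩

theorem mem_gapUnion (G : Set (ℕ × List ℕ)) (z : ℝ) :
    z ∈ gapUnion a G ↔ ∃ p ∈ G, z ∈ Gset a p.1 p.2 := by
  simp [gapUnion]

theorem gapUnion_rank (hk : StrictMono k) (hk1 : ∀ m, 1 ≤ m → 1 ≤ k m) :
    ∀ r m s, 1 ≤ m → s.length = k m - 1 → ∀ z,
      (z ∈ gapUnion a (gapFamily k 0 s m (m + r)) ↔ z - Jl a s ∈ Bs (dSeq a) k r m) ∧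
      (z ∈ gapUnion a (gapFamily k 1 s m (m + r)) ↔ Jr a s - z ∈ Bs (dSeq a) k r m) := by
  intro r
  induction r with
  | zero =>
    intro m s hm hs z
    have h1 := hk1 m hm
    have e : k m - 1 + 1 = k m := by omega
    have hm : ∀ i q, q ∈ gapFamily k i s m (m + 0) ↔ q = (i, s) := by
      intro i q; rw [gapFamily]; simp
    simp only [mem_gapUnion, hm, exists_eq_left, Gset, Gl, Gr, Jr, hs, e, Bs, Set.mem_Ioo]
    push_cast
    constructor <;> constructor <;> rintro ⟨h1, h2⟩ <;> constructor <;> linarith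
  | succ r ih =>
    intro m s hm hs z
    have h1 := hk1 m hm
    have h2 : k m < k (m + 1) := hk (Nat.lt_succ_self m)
    have e : k m - 1 + 1 = k m := by omega
    have em : m + (r + 1) = m + 1 + r := by ring
    have len : ∀ c e, (s ++ c :: List.replicate (k (m + 1) - k m - 1) e).length
        = k (m + 1) - 1 := by
      intro c e; simp [hs]; omega
    have I0 : ∀ c e, z ∈ gapUnion a (gapFamily k 0
        (s ++ c :: List.replicate (k (m + 1) - k m - 1) e) (m + 1) (m + 1 + r)) ↔ _ :=
      fun c e => (ih (m + 1) _ (by omega) (len c e) z).1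
    have I1 : ∀ c e, z ∈ gapUnion a (gapFamily k 1
        (s ++ c :: List.replicate (k (m + 1) - k m - 1) e) (m + 1) (m + 1 + r)) ↔ _ :=
      fun c e => (ih (m + 1) _ (by omega) (len c e) z).2
    have J0 : ∀ c : ℕ, Jl a (s ++ c :: List.replicate (k (m + 1) - k m - 1) 0) =
        Jl a s + c * (dSeq a (k m - 1) - dSeq a (k m)) := by
      intro c; rw [cons_split, Jl_rep0, Jl_append, hs, e]
    have J2 : ∀ c : ℕ, Jr a (s ++ c :: List.replicate (k (m + 1) - k m - 1) 2) =
        Jl a s + c * (dSeq a (k m - 1) - dSeq a (k m)) + 2 * dSeq a (k m) := by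
      intro c; rw [cons_split, Jr_rep2, Jr, Jl_append, hs, List.length_append,
        List.length_singleton, hs, e]
    have U : ∀ i, z ∈ gapUnion a (gapFamily k i s m (m + (r + 1))) ↔
        z ∈ gapUnion a (gapFamily k i
          (s ++ (2 * i) :: List.replicate (k (m + 1) - k m - 1) (2 * i)) (m + 1) (m + 1 + r)) ∨
        z ∈ gapUnion a (gapFamily k 1
          (s ++ i :: List.replicate (k (m + 1) - k m - 1) 2) (m + 1) (m + 1 + r)) ∨
        z ∈ gapUnion a (gapFamily k 0
          (s ++ (i + 1) :: List.replicate (k (m + 1) - k m - 1) 0) (m + 1) (m + 1 + r)) := by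
      intro i
      simp only [mem_gapUnion]
      rw [em]
      simp only [gapFamily_split hk i s m (m + 1 + r) (by omega), or_and_right, exists_or]
    constructor
    · rw [U, I0, I0, I1]
      simp only [mul_zero, J0, J2, Bs, Set.mem_ofPred_eq]
      push_cast
      refine or_congr ?_ (or_congr ?_ ?_)
      · ring_nf
      · ring_nf
      · ring_nf
    · rw [U, I0, I1, I1]
      rw [J0, mul_one, J2, J2]
      simp only [Bs, Set.mem_ofPred_eq, Jr, hs]
      push_cast
      have e1 : Jl a s + 2 * (dSeq a (k m - 1) - dSeq a (k m)) + 2 * dSeq a (k m) - z =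
        Jl a s + 2 * dSeq a (k m - 1) - z := by ring
      have e2 : Jl a s + 1 * (dSeq a (k m - 1) - dSeq a (k m)) + 2 * dSeq a (k m) - z =
        Jl a s + 2 * dSeq a (k m - 1) - z - (dSeq a (k m - 1) - dSeq a (k m)) := by ring
      have e3 : z - (Jl a s + 2 * (dSeq a (k m - 1) - dSeq a (k m))) =
        2 * dSeq a (k m) - (Jl a s + 2 * dSeq a (k m - 1) - z) := by ring
      rw [e1, e2, e3]
      tauto

theorem gapUnion_all (hk : StrictMono k) (hk1 : ∀ m, 1 ≤ m → 1 ≤ k m) (z : ℝ) :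
    z ∈ gapUnion a (gapFamilyT k 1 []) ↔
      (z + 1 ∈ ⋃ r, Bs (dSeq a) k r 1) ∨ (1 - z ∈ ⋃ r, Bs (dSeq a) k r 1) := by
  have d0 : dSeq a 0 = 1 := by simp [dSeq]
  have key : ∀ i c, z ∈ gapUnion a (gapFamilyAll k i ([] ++ List.replicate (k 1 - ([] : List ℕ).length - 1) c) 1) ↔
      ∃ r, z ∈ gapUnion a (gapFamily k i ([] ++ List.replicate (k 1 - 0 - 1) c) 1 (1 + r)) := by
    intro i c
    simp only [mem_gapUnion, gapFamilyAll, Set.mem_iUnion]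
    constructor
    · rintro ⟨p, ⟨n, hn, h⟩, hz⟩
      refine ⟨n - 1, p, ?_, hz⟩
      rw [Nat.add_sub_cancel' hn]; exact h
    · rintro ⟨r, p, h, hz⟩
      exact ⟨p, ⟨1 + r, by omega, h⟩, hz⟩
  have U : z ∈ gapUnion a (gapFamilyT k 1 []) ↔
      z ∈ gapUnion a (gapFamilyAll k 0 ([] ++ List.replicate (k 1 - ([] : List ℕ).length - 1) 0) 1) ∨
      z ∈ gapUnion a (gapFamilyAll k 1 ([] ++ List.replicate (k 1 - ([] : List ℕ).length - 1) 2) 1) := by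
    simp only [mem_gapUnion, gapFamilyT, Set.mem_union, or_and_right, exists_or]
  rw [U, key, key, Set.mem_iUnion, Set.mem_iUnion]
  have len : ∀ c, ([] ++ List.replicate (k 1 - 0 - 1) c : List ℕ).length = k 1 - 1 := by simp
  have jl : Jl a [] = -1 := by simp [Jl]
  have jr : Jr a [] = 1 := by simp [Jr, jl, d0]; norm_num
  refine or_congr (exists_congr fun r => ?_) (exists_congr fun r => ?_)
  · rw [(gapUnion_rank hk hk1 r 1 _ le_rfl (len 0) z).1, Jl_rep0, jl, sub_neg_eq_add]
  · rw [(gapUnion_rank hk hk1 r 1 _ le_rfl (len 2) z).2, Jr_rep2, jr]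

theorem Ks_list : ∀ f j z, z ∈ Ks (dSeq a) f j ↔
    ∃ t : List ℕ, (t.length = f ∧ ∀ i ∈ t, i ≤ 1) ∧
      (∑ i ∈ Finset.range t.length, (t.getD i 0 : ℝ) * (dSeq a (j + i) - dSeq a (j + i + 1))) ≤ z ∧
      z ≤ (∑ i ∈ Finset.range t.length,
        (t.getD i 0 : ℝ) * (dSeq a (j + i) - dSeq a (j + i + 1))) + dSeq a (j + f) := by
  intro f
  induction f with
  | zero =>
    intro j z
    simp only [Ks, Set.mem_Icc]
    constructor
    · intro h; exact ⟨[], ⟨rfl, by simp⟩, by simpa using h⟩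
    · rintro ⟨t, ⟨ht, -⟩, h⟩
      rw [List.length_eq_zero_iff] at ht
      subst ht
      simpa using h
  | succ f ih =>
    intro j z
    have S : ∀ (c : ℕ) (t : List ℕ), (∑ i ∈ Finset.range (c :: t).length,
        ((c :: t).getD i 0 : ℝ) * (dSeq a (j + i) - dSeq a (j + i + 1))) =
        (∑ i ∈ Finset.range t.length,
          (t.getD i 0 : ℝ) * (dSeq a (j + 1 + i) - dSeq a (j + 1 + i + 1))) +
          c * (dSeq a j - dSeq a (j + 1)) := by
      intro c t
      rw [List.length_cons, Finset.sum_range_succ']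
      congr 1
      refine Finset.sum_congr rfl fun i _ => ?_
      rw [List.getD_cons_succ]
      have : j + (i + 1) = j + 1 + i := by ring
      rw [this]
    have e : j + (f + 1) = j + 1 + f := by ring
    simp only [Ks, Set.mem_ofPred_eq, ih]
    rw [e]
    constructor
    · rintro (⟨t, ⟨h1, h2⟩, h3, h4⟩ | ⟨t, ⟨h1, h2⟩, h3, h4⟩)
      · refine ⟨0 :: t, ⟨by simp [h1], by simpa using h2⟩, ?_⟩
        rw [S]; push_cast
        constructor <;> linarith
      · refine ⟨1 :: t, ⟨by simp [h1], by simpa using h2⟩, ?_⟩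
        rw [S]; push_cast
        constructor <;> linarith
    · rintro ⟨t, ⟨h1, h2⟩, h⟩
      cases t with
      | nil => simp at h1
      | cons c t =>
        rw [S] at h
        have hc : c ≤ 1 := h2 c (by simp)
        have ht : ∀ i ∈ t, i ≤ 1 := fun i hi => h2 i (by simp [hi])
        have hl : t.length = f := by simpa using h1
        interval_cases c
        · left
          refine ⟨t, ⟨hl, ht⟩, ?_⟩
          push_cast at h
          constructor <;> linarith [h.1, h.2]
        · right
          refine ⟨t, ⟨hl, ht⟩, ?_⟩
          push_cast at h
          constructor <;> linarith [h.1, h.2]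

theorem cantorSet_eq : cantorSet a = ⋂ f, Ks (dSeq a) f 0 := by
  unfold cantorSet
  refine Set.iInter_congr fun n => ?_
  ext z
  rw [Ks_list]
  simp only [cantorStep, Set.mem_iUnion, Set.mem_ofPred_eq, Set.mem_Icc, exists_prop, Il, zero_add]

end lists

section final

variable {a : ℕ → ℝ} {k : ℕ → ℕ}

theorem dSeq_succ (a : ℕ → ℝ) (n : ℕ) :
    dSeq a (n + 1) = dSeq a n * ((1 - a (n + 1)) / 2) := by
  unfold dSeq
  rw [Finset.prod_Icc_succ_top (by omega)]

theorem dSeq_pos (ha : ∀ n, 1 ≤ n → 0 < a n ∧ a n < 1) (n : ℕ) : 0 < dSeq a n := by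
  refine Finset.prod_pos fun i hi => ?_
  have := ha i (Finset.mem_Icc.1 hi).1
  linarith [this.2]

theorem dSeq_half (ha : ∀ n, 1 ≤ n → 0 < a n ∧ a n < 1) (n : ℕ) :
    dSeq a (n + 1) < dSeq a n / 2 := by
  rw [dSeq_succ]
  have h1 := dSeq_pos ha n
  have h2 := (ha (n + 1) (by omega)).1
  nlinarith

theorem dSeq_gap (ha : ∀ n, 1 ≤ n → 0 < a n ∧ a n < 1) (n : ℕ) (h : 1 / 3 < a (n + 1)) :
    2 * dSeq a (n + 1) < dSeq a n - dSeq a (n + 1) := by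
  rw [dSeq_succ]
  have h1 := dSeq_pos ha n
  nlinarith

theorem dSeq_le (ha : ∀ n, 1 ≤ n → 0 < a n ∧ a n < 1) (n : ℕ) : dSeq a n ≤ (1 / 2) ^ n := by
  induction n with
  | zero => simp [dSeq]
  | succ n ih =>
    rw [pow_succ]
    linarith [dSeq_half ha n]

theorem tail_summable (ha : ∀ n, 1 ≤ n → 0 < a n ∧ a n < 1) (hk : StrictMono k) (l : ℕ) :
    Summable fun i : ℕ => dSeq a (k (l + 1 + i) - 1) - dSeq a (k (l + 1 + i)) := by
  have hanti : Antitone (dSeq a) := d_anti (dSeq_pos ha) (dSeq_half ha)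
  refine Summable.of_nonneg_of_le (f := fun i : ℕ => (1 / 2 : ℝ) ^ i) (fun i => ?_) (fun i => ?_)
    summable_geometric_two
  · linarith [hanti (Nat.sub_le (k (l + 1 + i)) 1)]
  · have h1 := dSeq_pos ha (k (l + 1 + i))
    have h2 : l + 1 + i ≤ k (l + 1 + i) := hk.id_le _
    have h3 := hanti (show i ≤ k (l + 1 + i) - 1 by omega)
    linarith [dSeq_le ha i]

theorem tail_nonneg (ha : ∀ n, 1 ≤ n → 0 < a n ∧ a n < 1) (l : ℕ) :
    0 ≤ tailSum a k l := by
  have hanti : Antitone (dSeq a) := d_anti (dSeq_pos ha) (dSeq_half ha)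
  refine tsum_nonneg fun i => ?_
  linarith [hanti (Nat.sub_le (k (l + 1 + i)) 1)]

theorem tail_succ (ha : ∀ n, 1 ≤ n → 0 < a n ∧ a n < 1) (hk : StrictMono k) (l : ℕ) :
    tailSum a k l = (dSeq a (k (l + 1) - 1) - dSeq a (k (l + 1))) + tailSum a k (l + 1) := by
  unfold tailSum
  rw [(tail_summable ha hk l).tsum_eq_zero_add]
  congr 1
  refine tsum_congr fun i => ?_
  have : l + 1 + (i + 1) = l + 1 + 1 + i := by ring
  rw [this]

theorem As_tail (ha : ∀ n, 1 ≤ n → 0 < a n ∧ a n < 1) (hk : StrictMono k)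
    (hgk' : ∀ j, 1 ≤ j → 1 / 3 < a j → ∃ n, 1 ≤ n ∧ k n = j) :
    ∀ f j l z, k l ≤ j → j < k (l + 1) → z ∈ As (dSeq a) (fun i => 1 / 3 < a i) f j →
      0 < z ∧ z < tailSum a k l := by
  intro f
  induction f with
  | zero => intro j l z _ _ h; exact absurd h (by simp [As])
  | succ f ih =>
    intro j l z h1 h2 h
    refine ⟨(As_bound (dSeq_pos ha) (dSeq_half ha) (fun n => dSeq_gap ha n) _ _ _ h).1, ?_⟩
    by_cases hj : j + 1 = k (l + 1)
    · have hlt : k (l + 1) < k (l + 1 + 1) := hk (Nat.lt_succ_self _)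
      have key := fun w hw => (ih (j + 1) (l + 1) w (by omega) (by omega) hw)
      have hT := tail_succ ha hk l
      have hT0 := tail_nonneg (k := k) ha (l + 1)
      rw [← hj, Nat.add_sub_cancel] at hT
      have hp := dSeq_pos ha (j + 1)
      have hhj := dSeq_half ha j
      rcases h with h | ⟨hgj, h | h | h⟩
      · linarith [(key _ h).2]
      · linarith [(key _ h).1, dSeq_gap ha j hgj]
      · linarith [h.2]
      · linarith [(key _ h).2]
    · rcases h with h | ⟨hgj, -⟩
      · exact (ih (j + 1) l z (by omega) (by omega) h).2
      · exfalso
        obtain ⟨n, hn, e⟩ := hgk' (j + 1) (by omega) hgj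
        have a1 : k l < k n := by omega
        have a2 : k n < k (l + 1) := by omega
        rw [hk.lt_iff_lt] at a1 a2
        omega

theorem star_real (hstar : condStar a k) (l i : ℕ) (hl : 1 ≤ l) (h1 : k (l - 1) + 1 ≤ i)
    (h2 : i ≤ k l - 1) :
    2 * tailSum a k l ≤ (3 * dSeq a i - dSeq a (i - 1)) - (dSeq a (k l - 1) - dSeq a (k l)) ∧
    2 * tailSum a k l ≤ 4 * dSeq a (k l) - (3 * dSeq a i - dSeq a (i - 1)) := by
  have h := hstar l hl
  rw [mSeq, le_min_iff] at h
  constructor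
  · have e : deltaMin a k l ≤ ((3 * dSeq a i - dSeq a (i - 1) : ℝ) : EReal) :=
      sInf_le ⟨i, ⟨h1, h2⟩, rfl⟩
    have := h.1.trans (EReal.sub_le_sub e le_rfl)
    rw [← EReal.coe_sub] at this
    exact EReal.coe_le_coe_iff.1 this
  · have e : ((3 * dSeq a i - dSeq a (i - 1) : ℝ) : EReal) ≤ deltaMax a k l :=
      le_sSup ⟨i, ⟨h1, h2⟩, rfl⟩
    have := h.2.trans (EReal.sub_le_sub le_rfl e)
    rw [← EReal.coe_sub] at this
    exact EReal.coe_le_coe_iff.1 this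

theorem hypStar (ha : ∀ n, 1 ≤ n → 0 < a n ∧ a n < 1) (hk : StrictMono k) (hk00 : k 0 = 0)
    (hgk : ∀ m, 1 ≤ m → 1 / 3 < a (k m))
    (hgk' : ∀ j, 1 ≤ j → 1 / 3 < a j → ∃ n, 1 ≤ n ∧ k n = j)
    (hstar : condStar a k) : HypStar (dSeq a) (fun i => 1 / 3 < a i) := by
  intro j hj
  have hex : ∃ l, j + 1 ≤ k l := ⟨j + 1, hk.id_le _⟩
  classical
  obtain ⟨l, hl, hmin⟩ : ∃ l, j + 1 ≤ k l ∧ ∀ l' < l, ¬ j + 1 ≤ k l' :=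
    ⟨Nat.find hex, Nat.find_spec hex, fun l' h => Nat.find_min hex h⟩
  have hl1 : 1 ≤ l := by
    by_contra h
    have : l = 0 := by omega
    subst this
    omega
  have hne : j + 1 ≠ k l := fun h => hj (by rw [h]; exact hgk l hl1)
  have hm := hmin (l - 1) (by omega)
  have st := star_real hstar l (j + 1) hl1 (by omega) (by omega)
  have hq := dSeq_gap ha (k l - 1) (by rw [Nat.sub_add_cancel (by omega)]; exact hgk l hl1)
  rw [Nat.sub_add_cancel (by omega)] at hq
  refine ⟨k l, tailSum a k l, by omega, hq, ?_, tail_nonneg ha l, ?_, st.1, st.2⟩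
  · intro i h1 h2 hg
    obtain ⟨n, hn, e⟩ := hgk' i (by omega) hg
    have a1 : k (l - 1) < k n := by omega
    have a2 : k n < k l := by omega
    rw [hk.lt_iff_lt] at a1 a2
    omega
  · intro f z hz
    exact As_tail ha hk hgk' f (k l) l z le_rfl (hk (Nat.lt_succ_self l)) hz

end final

/-- If `{n : aₙ > 1/3}` is infinite, `k₀ = 0` (i.e. `a₁ < 1/3`) and condition `(*)` holds,
then `C(a) - C(a) = [-1,1] ∖ ⋃ 𝒢_∅` and `|C(a) - C(a)| = 2 - 2 ∑ 3^{n-1}(d_{kₙ-1} - 3 d_{kₙ})`. -/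
theorem diffSet_eq_and_measure_of_condStar (a : ℕ → ℝ) (k : ℕ → ℕ)
    (ha : ∀ n, 1 ≤ n → 0 < a n ∧ a n < 1)
    (hinf : {n : ℕ | 1 ≤ n ∧ 1 / 3 < a n}.Infinite)
    (hk00 : k 0 = 0)
    (ha1 : a 1 < 1 / 3)
    (hk : IsGapEnum a k)
    (hstar : condStar a k) :
    cantorSet a - cantorSet a = Set.Icc (-1 : ℝ) 1 \ gapUnion a (gapFamilyT k 1 []) ∧
      volume (cantorSet a - cantorSet a) =
        ENNReal.ofReal
          (2 - 2 * ∑' n : ℕ, (3 : ℝ) ^ n * (dSeq a (k (n + 1) - 1) - 3 * dSeq a (k (n + 1)))) := by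
  obtain ⟨hmono, hk2, hk3⟩ := hk
  rw [hk00] at hk2 hk3
  have hp := dSeq_pos ha
  have hh := dSeq_half ha
  have hg : ∀ n, (fun i => 1 / 3 < a i) (n + 1) → 2 * dSeq a (n + 1) < dSeq a n - dSeq a (n + 1) :=
    fun n => dSeq_gap ha n
  have hk1 : ∀ m, 1 ≤ m → 1 ≤ k m := fun m hm => (hk2 m hm).1
  have hgk : ∀ m, 1 ≤ m → 1 / 3 < a (k m) := fun m hm => (hk2 m hm).2
  have hgkd : ∀ m, 1 ≤ m → 2 * dSeq a (k m) < dSeq a (k m - 1) - dSeq a (k m) := by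
    intro m hm
    have := dSeq_gap ha (k m - 1) (by rw [Nat.sub_add_cancel (hk1 m hm)]; exact hgk m hm)
    rwa [Nat.sub_add_cancel (hk1 m hm)] at this
  have hgk' : ∀ j, 1 ≤ j → 1 / 3 < a j → ∃ n, 1 ≤ n ∧ k n = j := fun j hj => hk3 j hj
  have H := hypStar ha hmono hk00 hgk hgk' hstar
  have d0 : dSeq a 0 = 1 := by simp [dSeq]
  have hAB : ∀ z, (∃ f, z ∈ As (dSeq a) (fun i => 1 / 3 < a i) f 0) ↔
      z ∈ ⋃ r, Bs (dSeq a) k r 1 := by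
    intro z
    rw [Set.mem_iUnion]
    constructor
    · rintro ⟨f, hf⟩
      exact As_to_Bs hmono hgk' f 0 1 z le_rfl (by simp [hk00]) (hk1 1 le_rfl) hf
    · rintro ⟨r, hr⟩
      obtain ⟨f, hf⟩ := Bs_to_As (g := fun i => 1 / 3 < a i) hmono hk1 hgk r 1 z le_rfl hr
      refine ⟨f + (k 1 - 1), As_skip _ _ _ _ ?_⟩
      rwa [zero_add]
  have first : cantorSet a - cantorSet a =
      Set.Icc (-1 : ℝ) 1 \ gapUnion a (gapFamilyT k 1 []) := by
    ext y
    rw [cantorSet_eq, inter_diff hp hh, Set.mem_sdiff, gapUnion_all hmono hk1, ← hAB, ← hAB, d0]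
    simp only [Rs_eq hp hh hg H, d0]
    have e : 2 * 1 - (y + 1) = 1 - y := by ring
    rw [e]
    constructor
    · intro h
      refine ⟨⟨by linarith [(h 0).1], by linarith [(h 0).2.1]⟩, ?_⟩
      rintro (⟨f, hf⟩ | ⟨f, hf⟩)
      · exact (h f).2.2.1 hf
      · exact (h f).2.2.2 hf
    · rintro ⟨⟨h1, h2⟩, h3⟩ f
      exact ⟨by linarith, by linarith, fun h => h3 (Or.inl ⟨f, h⟩), fun h => h3 (Or.inr ⟨f, h⟩)⟩
  refine ⟨first, ?_⟩
  rw [first]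
  set A := ⋃ r, Bs (dSeq a) k r 1 with hA
  have hAo : IsOpen A := isOpen_iUnion fun r => Bs_open r 1
  have hAb : ∀ z ∈ A, 0 < z ∧ z < 1 := by
    intro z hz
    obtain ⟨f, hf⟩ := (hAB z).2 hz
    have := As_bound hp hh hg f 0 z hf
    rwa [d0] at this
  have hU : gapUnion a (gapFamilyT k 1 []) =
      (fun z => z + 1) ⁻¹' A ∪ (fun z => 1 - z) ⁻¹' A := by
    ext z
    exact gapUnion_all hmono hk1 z
  have o2 : IsOpen ((fun z : ℝ => z + 1) ⁻¹' A) := hAo.preimage (by fun_prop)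
  have o3 : IsOpen ((fun z : ℝ => 1 - z) ⁻¹' A) := hAo.preimage (by fun_prop)
  have v2 : volume ((fun z : ℝ => z + 1) ⁻¹' A) = volume A :=
    (measurePreserving_add_right volume (1 : ℝ)).measure_preimage
      hAo.measurableSet.nullMeasurableSet
  have v3 : volume ((fun z : ℝ => 1 - z) ⁻¹' A) = volume A :=
    (Measure.measurePreserving_sub_left volume (1 : ℝ)).measure_preimage
      hAo.measurableSet.nullMeasurableSet
  have hvA : volume A = ENNReal.ofReal
      (∑' r : ℕ, (3 : ℝ) ^ r * (dSeq a (k (r + 1) - 1) - 3 * dSeq a (k (r + 1)))) :=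
    Bs_union_vol hp hh hmono hk1 hgkd
  have h0 : 0 ≤ ∑' r : ℕ, (3 : ℝ) ^ r * (dSeq a (k (r + 1) - 1) - 3 * dSeq a (k (r + 1))) := by
    refine tsum_nonneg fun r => ?_
    have := hgkd (r + 1) (by omega)
    have : 0 ≤ dSeq a (k (r + 1) - 1) - 3 * dSeq a (k (r + 1)) := by linarith
    positivity
  have hvU : volume (gapUnion a (gapFamilyT k 1 [])) = ENNReal.ofReal (2 *
      ∑' r : ℕ, (3 : ℝ) ^ r * (dSeq a (k (r + 1) - 1) - 3 * dSeq a (k (r + 1)))) := by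
    rw [hU, measure_union _ o3.measurableSet, v2, v3, hvA, ← ENNReal.ofReal_add h0 h0, two_mul]
    rw [Set.disjoint_left]
    intro z h1 h2
    linarith [(hAb _ h1).2, (hAb _ h2).2]
  have hsub : gapUnion a (gapFamilyT k 1 []) ⊆ Set.Icc (-1 : ℝ) 1 := by
    rw [hU]
    rintro z (h | h)
    · have := hAb _ h
      constructor <;> linarith [this.1, this.2]
    · have := hAb _ h
      constructor <;> linarith [this.1, this.2]
  rw [measure_sdiff hsub (by rw [hU]; exact (o2.union o3).measurableSet.nullMeasurableSet)
    (by rw [hvU]; exact ENNReal.ofReal_ne_top), hvU, Real.volume_Icc,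
    ← ENNReal.ofReal_sub _ (by linarith)]
  congr 1
  ring
end CCS
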